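/- arXiv:2509.06532 — 2 statements merged into one kernel-verified Lean document; each statement's English description precedes it below -/
import Mathlib

section
/- In the setting of the construction of the rational cubic trigonometric zipper fractal interpolation function (RCTZFIF): let t_1 < ... < t_n (n ≥ 3), data f_1, ..., f_n, derivatives d_1, ..., d_n, signature ε ∈ {0,1}^{n−1}, affine zipper maps L_{j,ε}(t) = a_j t + b_j with a_j = (t_{j+1−ε_j} − t_{j+ε_j})/(t_n − t_1) and b_j = (t_n t_{j+ε_j} − t_1 t_{j+1−ε_j})/(t_n − t_1), shape parameters α_j > 0, δ_j > 0, β_j ≥ 0, γ_j ≥ 0, and the rational cubic trigonometric functions M_{j,ε}(t) = p_j(θ(t))/q_j(θ(t)) built from U_j = α_j(f_{j+ε_j} − λ_j f_1), V_j = β_j(f_{j+ε_j} − λ_j f_1) + (2lα_j/π)(a_j d_{j+ε_j} − λ_j d_1), W_j = γ_j(f_{j+1−ε_j} − λ_j f_n) − (2lδ_j/π)(a_j d_{j+1−ε_j} − λ_j d_n), X_j = δ_j(f_{j+1−ε_j} − λ_j f_n), with θ(t) = (π/2)(t − t_1)/l and l = t_n − t_1. If in addition |λ_j| < |a_j| for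 every j = 1, ..., n−1, then the unique continuous function φ_ε on [t_1, t_n] satisfying φ_ε(L_{j,ε}(t)) = λ_j φ_ε(t) + M_{j,ε}(t) for all t and j is continuously differentiable on [t_1, t_n], and its derivative satisfies φ_ε'(t_i) = d_i for every i = 1, ..., n. -/
open Set Real

/-- A partition `x 0 ≤ x 1 ≤ ⋯ ≤ x m` covers `[x 0, x m]` by its consecutive intervals. -/
lemma exists_mem_Icc_succ {x : ℕ → ℝ} {m : ℕ} (hm : 0 < m) {y : ℝ}
    (hy : y ∈ Icc (x 0) (x m)) : ∃ j < m, y ∈ Icc (x j) (x (j + 1)) := by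
  induction m with
  | zero => exact absurd hm (lt_irrefl 0)
  | succ k ih =>
    by_cases hk : x k ≤ y
    · exact ⟨k, k.lt_succ_self, hk, hy.2⟩
    · rcases Nat.eq_zero_or_pos k with rfl | hk0
      · exact absurd hy.1 hk
      · obtain ⟨j, hj, hjy⟩ := ih hk0 ⟨hy.1, (not_le.1 hk).le⟩
        exact ⟨j, hj.trans k.lt_succ_self, hjy⟩

lemma le_of_forall_lt_le_succ {x : ℕ → ℝ} {m : ℕ} (hx : ∀ j < m, x j ≤ x (j + 1)) {i k : ℕ}
    (hik : i ≤ k) (hk : k ≤ m) : x i ≤ x k := by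
  induction k, hik using Nat.le_induction with
  | base => exact le_rfl
  | succ k _ ih => exact (ih (by lia)).trans (hx k (by lia))

/-- Functions on consecutive intervals which agree at the knots glue to a continuous function. -/
lemma exists_continuous_glue {x d : ℕ → ℝ} {m : ℕ} (hx : ∀ j < m, x j ≤ x (j + 1))
    {g : ℕ → ℝ → ℝ} (hg : ∀ j < m, ContinuousOn (g j) (Icc (x j) (x (j + 1))))
    (hl : ∀ j < m, g j (x j) = d j) (hr : ∀ j < m, g j (x (j + 1)) = d (j + 1)) :
    ∃ G : ℝ → ℝ, Continuous G ∧ (∀ i ≤ m, G (x i) = d i) ∧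
      ∀ j < m, ∀ y ∈ Icc (x j) (x (j + 1)), G y = g j y := by
  induction m with
  | zero =>
    refine ⟨fun _ => d 0, continuous_const, fun i hi => ?_, fun j hj => absurd hj (by lia)⟩
    rw [Nat.le_zero.1 hi]
  | succ k ih =>
    obtain ⟨G, hG, hGd, hGg⟩ := ih (fun j hj => hx j (by lia)) (fun j hj => hg j (by lia))
      (fun j hj => hl j (by lia)) (fun j hj => hr j (by lia))
    have hk := hx k k.lt_succ_self
    have hlk := hl k k.lt_succ_self
    have hrk := hr k k.lt_succ_self
    set H : ℝ → ℝ := IccExtend hk (domRestrict (Icc (x k) (x (k + 1))) (g k)) with hH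
    have hHc : Continuous H :=
      (continuousOn_iff_continuous_domRestrict.1 (hg k k.lt_succ_self)).Icc_extend'
    have hHl : ∀ y ≤ x k, H y = d k := fun y hy => by
      rw [hH, IccExtend_of_le_left hk _ hy, domRestrict_apply, hlk]
    have hHm : ∀ y ∈ Icc (x k) (x (k + 1)), H y = g k y := fun y hy => by
      rw [hH, IccExtend_of_mem hk _ hy, domRestrict_apply]
    have hGr : ∀ y, x k ≤ y → G (min y (x k)) = d k := fun y hy => by
      rw [min_eq_right hy, hGd k le_rfl]
    refine ⟨fun y => G (min y (x k)) + (H y - d k), by fun_prop, fun i hi => ?_,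
      fun j hj y hy => ?_⟩
    · rcases Nat.lt_or_ge k i with hki | hik
      · obtain rfl : i = k + 1 := by lia
        simp only [hGr _ hk, hHm _ (right_mem_Icc.2 hk), hrk]
        ring
      · have hxi : x i ≤ x k := le_of_forall_lt_le_succ hx hik (Nat.le_succ k)
        simp only [hHl _ hxi, min_eq_left hxi, hGd i hik]
        ring
    · rcases Nat.lt_or_ge j k with hjk | hkj
      · have hyk : y ≤ x k := hy.2.trans (le_of_forall_lt_le_succ hx hjk (Nat.le_succ k))
        simp only [hHl _ hyk, min_eq_left hyk, hGg j hjk y hy]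
        ring
      · obtain rfl : j = k := by lia
        simp only [hGr _ hy.1, hHm _ hy]
        ring

/-- A zipper of contractive vertical maps over a partition has a continuous fixed function
through the prescribed knots. -/
lemma exists_continuous_selfReferential {x d : ℕ → ℝ} {m : ℕ} (hm : 0 < m)
    (hx : ∀ j < m, x j < x (j + 1)) {c : ℕ → ℝ} (hc : ∀ j < m, |c j| < 1)
    {σ R : ℕ → ℝ → ℝ} (hσc : ∀ j < m, ContinuousOn (σ j) (Icc (x j) (x (j + 1))))
    (hσ : ∀ j < m, MapsTo (σ j) (Icc (x j) (x (j + 1))) (Icc (x 0) (x m)))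
    (hR : ∀ j < m, ContinuousOn (R j) (Icc (x j) (x (j + 1))))
    (hjoin : ∀ ψ : ℝ → ℝ, ψ (x 0) = d 0 → ψ (x m) = d m → ∀ j < m,
      c j * ψ (σ j (x j)) + R j (x j) = d j ∧
      c j * ψ (σ j (x (j + 1))) + R j (x (j + 1)) = d (j + 1)) :
    ∃ ψ : ℝ → ℝ, Continuous ψ ∧ (∀ i ≤ m, ψ (x i) = d i) ∧
      ∀ j < m, ∀ y ∈ Icc (x j) (x (j + 1)), ψ y = c j * ψ (σ j y) + R j y := by
  have hx' : ∀ j < m, x j ≤ x (j + 1) := fun j hj => (hx j hj).le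
  have h0m : x 0 < x m :=
    (hx 0 hm).trans_le (le_of_forall_lt_le_succ hx' hm le_rfl)
  have glue : ∀ ψ : ℝ → ℝ, Continuous ψ → ψ (x 0) = d 0 → ψ (x m) = d m →
      ∃ G : ℝ → ℝ, Continuous G ∧ (∀ i ≤ m, G (x i) = d i) ∧
        ∀ j < m, ∀ y ∈ Icc (x j) (x (j + 1)), G y = c j * ψ (σ j y) + R j y :=
    fun ψ hψ h0 h1 => exists_continuous_glue hx'
      (fun j hj => (continuousOn_const.mul (hψ.comp_continuousOn (hσc j hj))).add (hR j hj))
      (fun j hj => (hjoin ψ h0 h1 j hj).1) (fun j hj => (hjoin ψ h0 h1 j hj).2)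
  let A : Icc (x 0) (x m) := ⟨x 0, left_mem_Icc.2 h0m.le⟩
  let B : Icc (x 0) (x m) := ⟨x m, right_mem_Icc.2 h0m.le⟩
  let S : Set C(Icc (x 0) (x m), ℝ) := {ψ | ψ A = d 0 ∧ ψ B = d m}
  have hS : IsClosed S :=
    (isClosed_eq (continuous_eval_const A) continuous_const).inter
      (isClosed_eq (continuous_eval_const B) continuous_const)
  have : CompleteSpace S := hS.completeSpace_coe
  have : Nonempty S := by
    refine ⟨⟨⟨fun y => d 0 + (d m - d 0) * ((y - x 0) / (x m - x 0)), by fun_prop⟩, ?_, ?_⟩⟩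
    · simp [A]
    · simp [B, div_self (sub_pos.2 h0m).ne']
  let E : S → ℝ → ℝ := fun ψ => IccExtend h0m.le ψ.1
  have hEmem : ∀ (ψ : S) (y) (hy : y ∈ Icc (x 0) (x m)), E ψ y = ψ.1 ⟨y, hy⟩ :=
    fun ψ y hy => IccExtend_of_mem h0m.le _ hy
  have hEc : ∀ ψ : S, Continuous (E ψ) := fun ψ => ψ.1.continuous.Icc_extend'
  choose G hGc hGd hG using fun ψ : S => glue (E ψ) (hEc ψ)
    ((hEmem ψ _ A.2).trans ψ.2.1) ((hEmem ψ _ B.2).trans ψ.2.2)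
  let T : S → S := fun ψ => ⟨⟨fun y => G ψ y, (hGc ψ).comp continuous_subtype_val⟩,
    hGd ψ 0 (Nat.zero_le m), hGd ψ m le_rfl⟩
  let K : NNReal := (Finset.range m).sup fun j => ‖c j‖₊
  have hK : K < 1 := (Finset.sup_lt_iff one_pos).2 fun j hj => by
    rw [← NNReal.coe_lt_coe]
    simpa using hc j (Finset.mem_range.1 hj)
  have hcK : ∀ j < m, |c j| ≤ K := fun j hj => by
    have := Finset.le_sup (f := fun j => ‖c j‖₊) (Finset.mem_range.2 hj)
    rw [← NNReal.coe_le_coe] at this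
    simpa using this
  have hT : ContractingWith K T := by
    refine ⟨hK, LipschitzWith.of_dist_le_mul fun ψ χ => ?_⟩
    rw [Subtype.dist_eq, ContinuousMap.dist_le (by positivity)]
    intro y
    obtain ⟨j, hj, hjy⟩ := exists_mem_Icc_succ hm y.2
    have hs := hσ j hj hjy
    have hdist := ContinuousMap.dist_apply_le_dist (f := ψ.1) (g := χ.1) ⟨σ j y, hs⟩
    change dist (G ψ y) (G χ y) ≤ _
    rw [hG ψ j hj y hjy, hG χ j hj y hjy, hEmem ψ _ hs, hEmem χ _ hs, Subtype.dist_eq]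
    calc dist (c j * ψ.1 ⟨σ j y, hs⟩ + R j y) (c j * χ.1 ⟨σ j y, hs⟩ + R j y)
        = |c j| * dist (ψ.1 ⟨σ j y, hs⟩) (χ.1 ⟨σ j y, hs⟩) := by
          rw [dist_add_right, Real.dist_eq, Real.dist_eq, ← mul_sub, abs_mul]
      _ ≤ K * dist ψ.1 χ.1 := by
          gcongr
          exact hcK j hj
  set ψ : S := ContractingWith.fixedPoint T hT
  have hfix : T ψ = ψ := hT.fixedPoint_isFixedPt
  have hEG : ∀ y ∈ Icc (x 0) (x m), E ψ y = G ψ y := fun y hy => by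
    rw [hEmem ψ y hy]
    exact (DFunLike.congr_fun (congrArg Subtype.val hfix) ⟨y, hy⟩).symm
  refine ⟨G ψ, hGc ψ, hGd ψ, fun j hj y hy => ?_⟩
  rw [hG ψ j hj y hy, hEG _ (hσ j hj hy)]

/-- If the affine map `s ↦ a * s + b` carries the endpoints of `[A, B]` to those of an interval
`[A', B']` in some order, its inverse carries `[A', B']` into `[A, B]`. -/
lemma mapsTo_Icc_sub_div {A B A' B' a b : ℝ} (hAB : A < B) (h' : A' < B')
    (h : (a * A + b = A' ∧ a * B + b = B') ∨ (a * A + b = B' ∧ a * B + b = A')) :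
    MapsTo (fun y => (y - b) / a) (Icc A' B') (Icc A B) := by
  rintro y ⟨h1, h2⟩
  rcases h with ⟨hA, hB⟩ | ⟨hA, hB⟩
  · have ha : 0 < a := by
      by_contra! h
      nlinarith
    exact ⟨by rw [le_div_iff₀ ha]; linarith, by rw [div_le_iff₀ ha]; linarith⟩
  · have ha : a < 0 := by
      by_contra! h
      nlinarith
    exact ⟨by rw [le_div_iff_of_neg ha]; linarith, by rw [div_le_iff_of_neg ha]; linarith⟩

/-- Values of a chain whose increments are small multiples of its last value all vanish. -/
lemma eq_zero_of_abs_succ_sub_le {x e lam : ℕ → ℝ} {m : ℕ} (hm : 0 < m) (h0 : e 0 = 0)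
    (hlam : ∀ j < m, |lam j| * (x m - x 0) < x (j + 1) - x j)
    (hx : x 0 < x m)
    (he : ∀ j < m, |e (j + 1) - e j| = |lam j| * |e m|) : ∀ i ≤ m, e i = 0 := by
  have hem : e m = 0 := by
    by_contra hne
    have hpos : 0 < |e m| := abs_pos.2 hne
    have key : ∀ i, i + 1 ≤ m → |e (i + 1)| * (x m - x 0) < (x (i + 1) - x 0) * |e m| := by
      intro i
      induction i with
      | zero =>
        intro hi
        have h1 := he 0 hi
        rw [h0, sub_zero] at h1
        rw [h1]
        nlinarith [mul_lt_mul_of_pos_right (hlam 0 hi) hpos]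
      | succ i ih =>
        intro hi
        have h1 := he (i + 1) hi
        have h2 := abs_sub_abs_le_abs_sub (e (i + 1 + 1)) (e (i + 1))
        rw [h1] at h2
        nlinarith [mul_lt_mul_of_pos_right (hlam (i + 1) hi) hpos, ih (by lia),
          mul_le_mul_of_nonneg_right h2 (sub_pos.2 hx).le]
    obtain ⟨k, rfl⟩ : ∃ k, m = k + 1 := ⟨m - 1, by lia⟩
    have := key k le_rfl
    rw [mul_comm] at this
    exact lt_irrefl _ this
  intro i
  induction i with
  | zero => exact fun _ => h0
  | succ i ih =>
    intro hi
    have h1 := he i hi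
    rw [hem, ih (by lia), abs_zero, mul_zero, sub_zero] at h1
    exact abs_eq_zero.1 h1

/-- A continuous zipper fractal interpolation function with affine horizontal maps, vertical
scalings `|lam j| < |a j|` and Hermite-compatible `C¹` perturbations `M j` is continuously
differentiable and interpolates the derivative data. -/
theorem contDiffOn_and_derivWithin_of_selfReferential {x f d : ℕ → ℝ} {m : ℕ} (hm : 0 < m)
    (hx : ∀ j < m, x j < x (j + 1)) {u v : ℕ → ℕ}
    (huv : ∀ j < m, (u j = j ∧ v j = j + 1) ∨ (u j = j + 1 ∧ v j = j))
    {a b lam : ℕ → ℝ} (hA : ∀ j < m, a j * x 0 + b j = x (u j))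
    (hB : ∀ j < m, a j * x m + b j = x (v j)) (hlam : ∀ j < m, |lam j| < |a j|)
    {M : ℕ → ℝ → ℝ} (hM : ∀ j < m, ∀ s ∈ Icc (x 0) (x m), ContDiffAt ℝ 1 (M j) s)
    (hMA : ∀ j < m, M j (x 0) = f (u j) - lam j * f 0)
    (hMB : ∀ j < m, M j (x m) = f (v j) - lam j * f m)
    (hMA' : ∀ j < m, deriv (M j) (x 0) = a j * d (u j) - lam j * d 0)
    (hMB' : ∀ j < m, deriv (M j) (x m) = a j * d (v j) - lam j * d m)
    {φ : ℝ → ℝ} (hφ : ContinuousOn φ (Icc (x 0) (x m)))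
    (hφeq : ∀ j < m, ∀ s ∈ Icc (x 0) (x m), φ (a j * s + b j) = lam j * φ s + M j s) :
    ContDiffOn ℝ 1 φ (Icc (x 0) (x m)) ∧
      ∀ i ≤ m, derivWithin φ (Icc (x 0) (x m)) (x i) = d i := by
  have hx' : ∀ j < m, x j ≤ x (j + 1) := fun j hj => (hx j hj).le
  have h0m : x 0 < x m :=
    (hx 0 hm).trans_le (le_of_forall_lt_le_succ hx' hm le_rfl)
  have ha : ∀ j < m, a j ≠ 0 := fun j hj =>
    abs_pos.1 ((abs_nonneg _).trans_lt (hlam j hj))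
  have hmaps : ∀ j < m, MapsTo (fun y => (y - b j) / a j) (Icc (x j) (x (j + 1)))
      (Icc (x 0) (x m)) := fun j hj => by
    refine mapsTo_Icc_sub_div h0m (hx j hj) ?_
    rw [hA j hj, hB j hj]
    rcases huv j hj with ⟨h1, h2⟩ | ⟨h1, h2⟩ <;> simp [h1, h2]
  have hinvA : ∀ j < m, (x (u j) - b j) / a j = x 0 := fun j hj => by
    rw [← hA j hj]; field_simp [ha j hj]; ring
  have hinvB : ∀ j < m, (x (v j) - b j) / a j = x m := fun j hj => by
    rw [← hB j hj]; field_simp [ha j hj]; ring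
  have hLmem : ∀ j < m, ∀ s ∈ Icc (x 0) (x m), a j * s + b j ∈ Icc (x j) (x (j + 1)) := by
    intro j hj s hs
    have hAj := hA j hj
    have hBj := hB j hj
    have hxj := hx j hj
    rcases huv j hj with ⟨h1, h2⟩ | ⟨h1, h2⟩ <;> rw [h1] at hAj <;> rw [h2] at hBj
    · have : 0 < a j := by
        by_contra! h
        nlinarith
      constructor <;> nlinarith [hs.1, hs.2]
    · have : a j < 0 := by
        by_contra! h
        nlinarith
      constructor <;> nlinarith [hs.1, hs.2]
  obtain ⟨ψ, hψc, hψd, hψ⟩ := exists_continuous_selfReferential (d := d) hm hx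
    (c := fun j => lam j / a j) (σ := fun j y => (y - b j) / a j)
    (R := fun j y => deriv (M j) ((y - b j) / a j) / a j)
    (fun j hj => by
      rw [abs_div, div_lt_one (abs_pos.2 (ha j hj))]
      exact hlam j hj)
    (fun j _ => by fun_prop) hmaps
    (fun j hj => by
      have hM' : ContinuousOn (deriv (M j)) (Icc (x 0) (x m)) := fun s hs =>
        ((hM j hj s hs).derivWithin (m := 0) (by simp)).continuousAt.continuousWithinAt
      exact (hM'.comp (by fun_prop) (hmaps j hj)).div_const _)
    (fun ψ h0 h1 j hj => by
      have hu : lam j / a j * ψ ((x (u j) - b j) / a j) +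
          deriv (M j) ((x (u j) - b j) / a j) / a j = d (u j) := by
        rw [hinvA j hj, h0, hMA' j hj]
        field_simp [ha j hj]
        ring
      have hv : lam j / a j * ψ ((x (v j) - b j) / a j) +
          deriv (M j) ((x (v j) - b j) / a j) / a j = d (v j) := by
        rw [hinvB j hj, h1, hMB' j hj]
        field_simp [ha j hj]
        ring
      rcases huv j hj with ⟨h1, h2⟩ | ⟨h1, h2⟩ <;> rw [h1] at hu <;> rw [h2] at hv
      · exact ⟨hu, hv⟩
      · exact ⟨hv, hu⟩)
  set Φ : ℝ → ℝ := fun y => f 0 + ∫ z in (x 0)..y, ψ z with hΦdef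
  have hΦ : ∀ y, HasDerivAt Φ (ψ y) y := fun y =>
    (hψc.integral_hasStrictDerivAt (x 0) y).hasDerivAt.const_add _
  have hΦ0 : Φ (x 0) = f 0 := by simp [hΦdef]
  have hconst : ∀ j < m, ∀ s ∈ Icc (x 0) (x m),
      Φ (a j * s + b j) - lam j * Φ s - M j s = Φ (x (u j)) - f (u j) := by
    intro j hj
    have hder : ∀ s ∈ Icc (x 0) (x m),
        HasDerivAt (fun s => Φ (a j * s + b j) - lam j * Φ s - M j s) 0 s := by
      intro s hs
      have h1 : HasDerivAt (fun s => a j * s + b j) (a j) s := by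
        simpa using ((hasDerivAt_id s).const_mul (a j)).add_const (b j)
      have h2 := (((hΦ (a j * s + b j)).comp s h1).sub ((hΦ s).const_mul (lam j))).sub
        ((hM j hj s hs).differentiableAt (by simp)).hasDerivAt
      refine h2.congr_deriv ?_
      have h3 : (a j * s + b j - b j) / a j = s := by field_simp [ha j hj]; ring
      rw [hψ j hj _ (hLmem j hj s hs)]
      simp only [h3]
      field_simp [ha j hj]
      ring
    intro s hs
    rw [constant_of_has_deriv_right_zero
      (fun s hs => (hder s hs).continuousAt.continuousWithinAt)
      (fun s hs => (hder s (Ico_subset_Icc_self hs)).hasDerivWithinAt) s hs,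
      hA j hj, hMA j hj, hΦ0]
    ring
  have hE : ∀ i ≤ m, Φ (x i) - f i = 0 := by
    refine eq_zero_of_abs_succ_sub_le (x := x) (lam := lam) (e := fun i => Φ (x i) - f i) hm
      (by simp [hΦ0]) (fun j hj => ?_) h0m (fun j hj => ?_)
    · have h1 : |a j| * (x m - x 0) = x (j + 1) - x j := by
        rw [← abs_of_pos (sub_pos.2 h0m), ← abs_mul, mul_sub,
          ← abs_of_pos (sub_pos.2 (hx j hj)), show a j * x m - a j * x 0 = x (v j) - x (u j) by
            rw [← hA j hj, ← hB j hj]; ring]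
        rcases huv j hj with ⟨h1, h2⟩ | ⟨h1, h2⟩ <;> rw [h1, h2]
        exact abs_sub_comm _ _
      rw [← h1]
      exact mul_lt_mul_of_pos_right (hlam j hj) (sub_pos.2 h0m)
    · have h1 := hconst j hj (x m) (right_mem_Icc.2 h0m.le)
      rw [hB j hj, hMB j hj] at h1
      have h2 : (Φ (x (v j)) - f (v j)) - (Φ (x (u j)) - f (u j)) =
          lam j * (Φ (x m) - f m) := by linarith
      rw [← abs_mul, ← h2]
      rcases huv j hj with ⟨h3, h4⟩ | ⟨h3, h4⟩ <;> rw [h3, h4]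
      exact abs_sub_comm _ _
  have hΦeq : ∀ j < m, ∀ s ∈ Icc (x 0) (x m), Φ (a j * s + b j) = lam j * Φ s + M j s := by
    intro j hj s hs
    have h1 := hconst j hj s hs
    rw [hE (u j) (by rcases huv j hj with ⟨h, _⟩ | ⟨h, _⟩ <;> lia)] at h1
    linarith
  have hΦc : Continuous Φ := continuous_iff_continuousAt.2 fun y => (hΦ y).continuousAt
  have heq : EqOn φ Φ (Icc (x 0) (x m)) := by
    obtain ⟨y₀, hy₀, hmax⟩ := isCompact_Icc.exists_isMaxOn (nonempty_Icc.2 h0m.le)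
      (hφ.sub hΦc.continuousOn).abs
    have hy₀0 : |φ y₀ - Φ y₀| ≤ 0 := by
      obtain ⟨j, hj, hjy⟩ := exists_mem_Icc_succ hm hy₀
      have hs := hmaps j hj hjy
      set s := (y₀ - b j) / a j with hsdef
      have hys : y₀ = a j * s + b j := by rw [hsdef]; field_simp [ha j hj]; ring
      have h1 : |φ y₀ - Φ y₀| = |lam j| * |φ s - Φ s| := by
        rw [hys, hφeq j hj s hs, hΦeq j hj s hs, ← abs_mul]
        ring_nf
      have h2 : |φ s - Φ s| ≤ |φ y₀ - Φ y₀| := hmax hs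
      have h3 : |a j| ≤ 1 := by
        have h4 := hLmem j hj _ (left_mem_Icc.2 h0m.le)
        have h5 := hLmem j hj _ (right_mem_Icc.2 h0m.le)
        have h6 : x 0 ≤ x j := le_of_forall_lt_le_succ hx' (Nat.zero_le j) hj.le
        have h7 : x (j + 1) ≤ x m := le_of_forall_lt_le_succ hx' hj le_rfl
        have hpos := sub_pos.2 h0m
        rw [abs_le]
        constructor <;> nlinarith [h4.1, h4.2, h5.1, h5.2]
      nlinarith [hlam j hj, abs_nonneg (lam j), abs_nonneg (φ s - Φ s),
        abs_nonneg (φ y₀ - Φ y₀), mul_le_mul_of_nonneg_left h2 (abs_nonneg (lam j))]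
    intro y hy
    have h1 : |φ y - Φ y| ≤ |φ y₀ - Φ y₀| := hmax hy
    exact sub_eq_zero.1 (abs_nonpos_iff.1 (h1.trans hy₀0))
  have hderiv : deriv Φ = ψ := funext fun y => (hΦ y).deriv
  have hΦC1 : ContDiff ℝ 1 Φ :=
    contDiff_one_iff_deriv.2 ⟨fun y => (hΦ y).differentiableAt, hderiv ▸ hψc⟩
  refine ⟨hΦC1.contDiffOn.congr heq, fun i hi => ?_⟩
  have hi' : x i ∈ Icc (x 0) (x m) :=
    ⟨le_of_forall_lt_le_succ hx' (Nat.zero_le i) hi, le_of_forall_lt_le_succ hx' hi le_rfl⟩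
  rw [derivWithin_congr heq (heq hi'),
    (hΦ (x i)).hasDerivWithinAt.derivWithin (uniqueDiffOn_Icc h0m _ hi'), hψd i hi]

/-- The cubic trigonometric blend of the coefficients `u, v, w, z`. -/
noncomputable def cubicTrig (u v w z θ : ℝ) : ℝ :=
  (1 - sin θ) ^ 3 * u + sin θ * (1 - sin θ) ^ 2 * v + cos θ * (1 - cos θ) ^ 2 * w +
    (1 - cos θ) ^ 3 * z

namespace cubicTrig

variable (u v w z : ℝ)

lemma contDiff : ContDiff ℝ 1 (cubicTrig u v w z) := by
  unfold cubicTrig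
  fun_prop

@[simp] lemma apply_zero : cubicTrig u v w z 0 = u := by simp [cubicTrig]

@[simp] lemma apply_pi_div_two : cubicTrig u v w z (π / 2) = z := by simp [cubicTrig]

lemma hasDerivAt (θ : ℝ) : HasDerivAt (cubicTrig u v w z)
    (-3 * (1 - sin θ) ^ 2 * cos θ * u +
      (cos θ * (1 - sin θ) ^ 2 - 2 * sin θ * (1 - sin θ) * cos θ) * v +
      (-sin θ * (1 - cos θ) ^ 2 + 2 * cos θ * (1 - cos θ) * sin θ) * w +
      3 * (1 - cos θ) ^ 2 * sin θ * z) θ := by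
  have hs := (hasDerivAt_sin θ).const_sub 1
  have hc := (hasDerivAt_cos θ).const_sub 1
  refine (((((hs.pow 3).mul_const u).add
    (((hasDerivAt_sin θ).mul (hs.pow 2)).mul_const v)).add
    (((hasDerivAt_cos θ).mul (hc.pow 2)).mul_const w)).add
    ((hc.pow 3).mul_const z)).congr_deriv ?_
  norm_num
  ring

lemma hasDerivAt_zero : HasDerivAt (cubicTrig u v w z) (v - 3 * u) 0 :=
  (hasDerivAt u v w z 0).congr_deriv (by simp; ring)

lemma hasDerivAt_pi_div_two : HasDerivAt (cubicTrig u v w z) (3 * z - w) (π / 2) :=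
  (hasDerivAt u v w z (π / 2)).congr_deriv (by simp; ring)

variable {u v w z}

lemma pos (hu : 0 < u) (hv : 0 ≤ v) (hw : 0 ≤ w) (hz : 0 < z) {θ : ℝ}
    (hθ : θ ∈ Icc 0 (π / 2)) : 0 < cubicTrig u v w z θ := by
  have hs0 : 0 ≤ sin θ := sin_nonneg_of_nonneg_of_le_pi hθ.1 (by linarith [hθ.2, pi_pos])
  have hc0 : 0 ≤ cos θ := cos_nonneg_of_neg_pi_div_two_le_of_le (by linarith [hθ.1, pi_pos]) hθ.2
  have hs1 : 0 ≤ 1 - sin θ := sub_nonneg.2 (sin_le_one θ)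
  have hc1 : 0 ≤ 1 - cos θ := sub_nonneg.2 (cos_le_one θ)
  unfold cubicTrig
  rcases hs1.eq_or_lt with h | h
  · have hc : 0 < 1 - cos θ := by nlinarith [sin_sq_add_cos_sq θ]
    positivity
  · positivity

end cubicTrig

/-- If moreover `|λ j| < |a j|` for every `j`, then the RCTZFIF
`φ_ε` is continuously differentiable on `[t 1, t n]` and its derivative
interpolates the derivative data: `φ_ε'(t i) = d i` for all `i`. -/
theorem RCTZFIF_C1_and_derivative_interpolation
    (n : ℕ) (hn : 3 ≤ n)
    (t f d : ℕ → ℝ)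
    (ht : ∀ i, 1 ≤ i → i ≤ n - 1 → t i < t (i + 1))
    (ε : ℕ → ℕ) (hε : ∀ j, 1 ≤ j → j ≤ n - 1 → ε j = 0 ∨ ε j = 1)
    (l : ℝ) (hl : l = t n - t 1)
    (θf : ℝ → ℝ) (hθf : ∀ s : ℝ, θf s = (π / 2) * (s - t 1) / l)
    (a b : ℕ → ℝ)
    (ha : ∀ j, 1 ≤ j → j ≤ n - 1 →
      a j = (t (j + 1 - ε j) - t (j + ε j)) / (t n - t 1))
    (hb : ∀ j, 1 ≤ j → j ≤ n - 1 →
      b j = (t n * t (j + ε j) - t 1 * t (j + 1 - ε j)) / (t n - t 1))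
    (L : ℕ → ℝ → ℝ)
    (hL : ∀ j, 1 ≤ j → j ≤ n - 1 → ∀ s : ℝ, L j s = a j * s + b j)
    (lam : ℕ → ℝ)
    (hlam : ∀ j, 1 ≤ j → j ≤ n - 1 → |lam j| < |a j|)
    (α β γ δ : ℕ → ℝ)
    (hα : ∀ j, 1 ≤ j → j ≤ n - 1 → 0 < α j)
    (hδ : ∀ j, 1 ≤ j → j ≤ n - 1 → 0 < δ j)
    (hβ : ∀ j, 1 ≤ j → j ≤ n - 1 → 0 ≤ β j)
    (hγ : ∀ j, 1 ≤ j → j ≤ n - 1 → 0 ≤ γ j)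
    (U V W X : ℕ → ℝ)
    (hU : ∀ j, 1 ≤ j → j ≤ n - 1 → U j = α j * (f (j + ε j) - lam j * f 1))
    (hV : ∀ j, 1 ≤ j → j ≤ n - 1 →
      V j = β j * (f (j + ε j) - lam j * f 1) +
        (2 * l * α j / π) * (a j * d (j + ε j) - lam j * d 1))
    (hW : ∀ j, 1 ≤ j → j ≤ n - 1 →
      W j = γ j * (f (j + 1 - ε j) - lam j * f n) -
        (2 * l * δ j / π) * (a j * d (j + 1 - ε j) - lam j * d n))
    (hX : ∀ j, 1 ≤ j → j ≤ n - 1 → X j = δ j * (f (j + 1 - ε j) - lam j * f n))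
    (p q : ℕ → ℝ → ℝ)
    (hp : ∀ j, 1 ≤ j → j ≤ n - 1 → ∀ θ : ℝ,
      p j θ = (1 - sin θ) ^ 3 * U j + sin θ * (1 - sin θ) ^ 2 * V j +
        cos θ * (1 - cos θ) ^ 2 * W j + (1 - cos θ) ^ 3 * X j)
    (hq : ∀ j, 1 ≤ j → j ≤ n - 1 → ∀ θ : ℝ,
      q j θ = (1 - sin θ) ^ 3 * α j + sin θ * (1 - sin θ) ^ 2 * β j +
        cos θ * (1 - cos θ) ^ 2 * γ j + (1 - cos θ) ^ 3 * δ j)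
    (M : ℕ → ℝ → ℝ)
    (hM : ∀ j, 1 ≤ j → j ≤ n - 1 → ∀ s : ℝ, M j s = p j (θf s) / q j (θf s))
    -- `φ` is the (unique) continuous solution of the self-referential equations
    (φ : ℝ → ℝ)
    (hφcont : ContinuousOn φ (Icc (t 1) (t n)))
    (hφeq : ∀ j, 1 ≤ j → j ≤ n - 1 → ∀ s ∈ Icc (t 1) (t n),
      φ (L j s) = lam j * φ s + M j s) :
    ContDiffOn ℝ 1 φ (Icc (t 1) (t n)) ∧
    ∀ i, 1 ≤ i → i ≤ n → derivWithin φ (Icc (t 1) (t n)) (t i) = d i := by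
  have ht1n : t 1 < t n := by
    have h1 := ht 1 le_rfl (by lia)
    have h2 := le_of_forall_lt_le_succ (x := fun i => t (i + 1)) (m := n - 1) (i := 1)
      (k := n - 1) (fun j hj => (ht (j + 1) (by lia) (by lia)).le) (by lia) le_rfl
    simp only [show n - 1 + 1 = n by lia] at h2
    exact h1.trans_le h2
  have hl0 : 0 < l := hl ▸ sub_pos.2 ht1n
  have hlne := hl0.ne'
  have hpi := pi_pos.ne'
  have hn1 : n - 1 + 1 = n := by lia
  have hθ1 : θf (t 1) = 0 := by simp [hθf]
  have hθn : θf (t n) = π / 2 := by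
    rw [hθf, ← hl]
    field_simp
  have hθd : ∀ s, HasDerivAt θf (π / 2 / l) s := fun s => by
    rw [show θf = fun s => π / 2 * (s - t 1) / l from funext hθf]
    simpa using (((hasDerivAt_id s).sub_const (t 1)).const_mul (π / 2)).div_const l
  have hθC : ContDiff ℝ 1 θf := by
    rw [show θf = fun s => π / 2 * (s - t 1) / l from funext hθf]
    fun_prop
  have hθmem : ∀ s ∈ Icc (t 1) (t n), θf s ∈ Icc 0 (π / 2) := fun s hs => by
    rw [hθf]
    have h1 : 0 ≤ s - t 1 := sub_nonneg.2 hs.1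
    refine ⟨by positivity, ?_⟩
    rw [div_le_iff₀ hl0, hl]
    gcongr
    exact hs.2
  have hMeq : ∀ j, 1 ≤ j → j ≤ n - 1 → M j = fun s =>
      cubicTrig (U j) (V j) (W j) (X j) (θf s) / cubicTrig (α j) (β j) (γ j) (δ j) (θf s) :=
    fun j h1 h2 => funext fun s => by rw [hM j h1 h2, hp j h1 h2, hq j h1 h2]; rfl
  have key := contDiffOn_and_derivWithin_of_selfReferential (m := n - 1)
    (x := fun i => t (i + 1)) (f := fun i => f (i + 1)) (d := fun i => d (i + 1))
    (u := fun j => j + ε (j + 1)) (v := fun j => j + 1 - ε (j + 1))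
    (a := fun j => a (j + 1)) (b := fun j => b (j + 1)) (lam := fun j => lam (j + 1))
    (M := fun j => M (j + 1)) (φ := φ)
  simp only [zero_add, hn1] at key
  have hu : ∀ j, j + ε (j + 1) + 1 = j + 1 + ε (j + 1) := fun j => by lia
  have hv : ∀ j < n - 1, j + 1 - ε (j + 1) + 1 = j + 1 + 1 - ε (j + 1) := fun j hj => by
    rcases hε (j + 1) (by lia) (by lia) with h | h <;> lia
  have hne : t n - t 1 ≠ 0 := (sub_pos.2 ht1n).ne'
  obtain ⟨hC, hd⟩ := key (by lia) (fun j hj => ht (j + 1) (by lia) (by lia))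
    (fun j hj => by rcases hε (j + 1) (by lia) (by lia) with h | h <;> lia)
    (fun j hj => by
      rw [ha (j + 1) (by lia) (by lia), hb (j + 1) (by lia) (by lia), hu]
      field_simp
      ring)
    (fun j hj => by
      rw [ha (j + 1) (by lia) (by lia), hb (j + 1) (by lia) (by lia), hv j hj]
      field_simp
      ring)
    (fun j hj => hlam (j + 1) (by lia) (by lia))
    (fun j hj s hs => by
      rw [hMeq (j + 1) (by lia) (by lia)]
      exact ((cubicTrig.contDiff _ _ _ _).comp hθC).contDiffAt.div
        ((cubicTrig.contDiff _ _ _ _).comp hθC).contDiffAt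
        (cubicTrig.pos (hα _ (by lia) (by lia)) (hβ _ (by lia) (by lia)) (hγ _ (by lia) (by lia))
          (hδ _ (by lia) (by lia)) (hθmem s hs)).ne')
    (fun j hj => by
      have hα0 := (hα (j + 1) (by lia) (by lia)).ne'
      rw [hMeq (j + 1) (by lia) (by lia), hu]
      simp only [hθ1, cubicTrig.apply_zero, hU (j + 1) (by lia) (by lia)]
      field_simp)
    (fun j hj => by
      have hδ0 := (hδ (j + 1) (by lia) (by lia)).ne'
      rw [hMeq (j + 1) (by lia) (by lia), hv j hj]
      simp only [hθn, cubicTrig.apply_pi_div_two, hX (j + 1) (by lia) (by lia)]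
      field_simp)
    (fun j hj => by
      have hα0 := (hα (j + 1) (by lia) (by lia)).ne'
      have hderiv (u v w z : ℝ) :
          HasDerivAt (fun s => cubicTrig u v w z (θf s)) ((v - 3 * u) * (π / 2 / l)) (t 1) :=
        (cubicTrig.hasDerivAt_zero u v w z).comp_of_eq (t 1) (hθd (t 1)) hθ1.symm
      rw [hMeq (j + 1) (by lia) (by lia), hu]
      refine ((hderiv _ _ _ _).div (hderiv _ _ _ _) (by simpa [hθ1] using hα0)).deriv.trans ?_
      simp only [hθ1, cubicTrig.apply_zero, hU (j + 1) (by lia) (by lia),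
        hV (j + 1) (by lia) (by lia)]
      field_simp
      ring)
    (fun j hj => by
      have hδ0 := (hδ (j + 1) (by lia) (by lia)).ne'
      have hderiv (u v w z : ℝ) :
          HasDerivAt (fun s => cubicTrig u v w z (θf s)) ((3 * z - w) * (π / 2 / l)) (t n) :=
        (cubicTrig.hasDerivAt_pi_div_two u v w z).comp_of_eq (t n) (hθd (t n)) hθn.symm
      rw [hMeq (j + 1) (by lia) (by lia), hv j hj]
      refine ((hderiv _ _ _ _).div (hderiv _ _ _ _) (by simpa [hθn] using hδ0)).deriv.trans ?_
      simp only [hθn, cubicTrig.apply_pi_div_two, hX (j + 1) (by lia) (by lia),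
        hW (j + 1) (by lia) (by lia)]
      field_simp
      ring)
    hφcont
    (fun j hj s hs => by
      rw [← hL (j + 1) (by lia) (by lia)]
      exact hφeq (j + 1) (by lia) (by lia) s hs)
  refine ⟨hC, fun i h1 h2 => ?_⟩
  obtain ⟨k, rfl⟩ : ∃ k, i = k + 1 := ⟨i - 1, by lia⟩
  exact hd k (by lia)
end

section
/- Let t_1 < ... < t_n (n ≥ 3) be real numbers with strictly positive data f_1, ..., f_n > 0 and derivative values d_1, ..., d_n ∈ ℝ; let ε ∈ {0,1}^{n−1} be a signature, l = t_n − t_1, θ(t) = (π/2)(t − t_1)/l. For j = 1, ..., n−1 set a_j = (t_{j+1−ε_j} − t_{j+ε_j})/(t_n − t_1), b_j = (t_n t_{j+ε_j} − t_1 t_{j+1−ε_j})/(t_n − t_1), L_{j,ε}(t) = a_j t + b_j. Suppose for every j: (i) 0 ≤ λ_j < min{|a_j|, f_{j+ε_j}/f_1, f_{j+1−ε_j}/f_n}; (ii) α_j > 0, δ_j > 0, β_j > max{0, −2lα_j d_j*/(π f_j*)}, γ_j > max{0, 2lδ_j d_{j+1}*/(π f_{j+1}*)}, where f_j* = f_{j+ε_j}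 − λ_j f_1, f_{j+1}* = f_{j+1−ε_j} − λ_j f_n, d_j* = a_j d_{j+ε_j} − λ_j d_1, d_{j+1}* = a_j d_{j+1−ε_j} − λ_j d_n. Define U_j = α_j f_j*, V_j = β_j f_j* + (2lα_j/π) d_j*, W_j = γ_j f_{j+1}* − (2lδ_j/π) d_{j+1}*, X_j = δ_j f_{j+1}*, p_j(θ) = (1 − sin θ)^3 U_j + sin θ(1 − sin θ)^2 V_j + cos θ(1 − cos θ)^2 W_j + (1 − cos θ)^3 X_j, q_j(θ) = (1 − sin θ)^3 α_j + sin θ(1 − sin θ)^2 β_j + cos θ(1 − cos θ)^2 γ_j + (1 − cos θ)^3 δ_j, and M_{j,ε}(t) = p_j(θ(t))/q_j(θ(t)). Then the unique continuous function φ_ε on [t_1, t_n] satisfying φ_ε(L_{j,ε}(t)) = λ_j φ_ε(t) + M_{j,ε}(t) for all t ∈ [t_1, t_n] and all j (which interpolates φ_ε(t_i) = f_i for all i) is strictly positive: φ_ε(t) > 0 for all t ∈ [t_1, t_n]. -/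
open Set Real

/-- The cubic trigonometric form with positive coefficients is positive on `[0, π / 2]`. -/
theorem cubicTrig_pos {u v w x θ : ℝ} (hu : 0 < u) (hv : 0 < v) (hw : 0 < w) (hx : 0 < x)
    (hθ : θ ∈ Icc 0 (π / 2)) :
    0 < (1 - sin θ) ^ 3 * u + sin θ * (1 - sin θ) ^ 2 * v +
      cos θ * (1 - cos θ) ^ 2 * w + (1 - cos θ) ^ 3 * x := by
  have hs : 0 ≤ sin θ := sin_nonneg_of_mem_Icc ⟨hθ.1, by linarith [hθ.2, pi_pos]⟩
  have hc : 0 ≤ cos θ := cos_nonneg_of_mem_Icc ⟨by linarith [hθ.1, pi_pos], hθ.2⟩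
  have hs1 : 0 ≤ 1 - sin θ := sub_nonneg.2 (sin_le_one θ)
  have hc1 : 0 ≤ 1 - cos θ := sub_nonneg.2 (cos_le_one θ)
  rcases hs1.eq_or_lt with h | h
  · have hsin : sin θ = 1 := by linarith
    have hcos : cos θ = 0 := by
      have := sin_sq_add_cos_sq θ
      rw [hsin] at this
      exact pow_eq_zero_iff two_ne_zero |>.1 (by linarith)
    simpa [hsin, hcos] using hx
  · positivity

/-- A point of a partitioned interval lies in one of the cells of the partition. -/
theorem exists_mem_Icc_succ_s11 {t : ℕ → ℝ} {s : ℝ} (n : ℕ) (hn : 2 ≤ n) (h1 : t 1 ≤ s)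
    (h2 : s ≤ t n) : ∃ j, 1 ≤ j ∧ j ≤ n - 1 ∧ s ∈ Icc (t j) (t (j + 1)) := by
  induction n, hn using Nat.le_induction with
  | base => exact ⟨1, le_rfl, le_rfl, h1, h2⟩
  | succ m hm ih =>
    rcases le_total s (t m) with h | h
    · obtain ⟨j, hj1, hj2, hj⟩ := ih h
      exact ⟨j, hj1, by omega, hj⟩
    · exact ⟨m, by omega, by omega, h, h2⟩

/-- The affine map sending `x` to `A` and `y` to `B` maps `[x, y]` onto the segment from `A`
to `B`. -/
theorem exists_affine_preimage {x y A B s : ℝ} (hxy : x < y) (hAB : A ≠ B)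
    (hs : s ∈ uIcc A B) :
    ∃ r ∈ Icc x y, (B - A) / (y - x) * r + (y * A - x * B) / (y - x) = s := by
  have hyx : y - x ≠ 0 := (sub_pos.2 hxy).ne'
  have hBA : B - A ≠ 0 := sub_ne_zero.2 hAB.symm
  have hc : (s - A) / (B - A) ∈ Icc (0 : ℝ) 1 := by
    rcases hAB.lt_or_gt with h | h
    · rw [uIcc_of_le h.le] at hs
      exact ⟨div_nonneg (by linarith [hs.1]) (by linarith),
        (div_le_one (by linarith)).2 (by linarith [hs.2])⟩
    · rw [uIcc_of_ge h.le] at hs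
      exact ⟨div_nonneg_of_nonpos (by linarith [hs.2]) (by linarith),
        (div_le_one_of_neg (by linarith)).2 (by linarith [hs.1])⟩
  refine ⟨x + (y - x) * ((s - A) / (B - A)), ⟨?_, ?_⟩, ?_⟩
  · nlinarith [hc.1]
  · nlinarith [hc.2]
  · field_simp
    ring

/-- Positivity preservation for the rational cubic trigonometric
zipper fractal interpolation function: under the stated constraints on the scaling
factors `λ j` and shape parameters `α j, β j, γ j, δ j`, the unique continuous
function `φ_ε` satisfying the self-referential equations (which interpolates the
positive data) is strictly positive on `[t 1, t n]`. -/
theorem RCTZFIF_positivity_preservation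
    (n : ℕ) (hn : 3 ≤ n)
    (t f d : ℕ → ℝ)
    (ht : ∀ i, 1 ≤ i → i ≤ n - 1 → t i < t (i + 1))
    (hf : ∀ i, 1 ≤ i → i ≤ n → 0 < f i)
    (ε : ℕ → ℕ) (hε : ∀ j, 1 ≤ j → j ≤ n - 1 → ε j = 0 ∨ ε j = 1)
    (l : ℝ) (hl : l = t n - t 1)
    (θf : ℝ → ℝ) (hθf : ∀ s : ℝ, θf s = (π / 2) * (s - t 1) / l)
    (a b : ℕ → ℝ)
    (ha : ∀ j, 1 ≤ j → j ≤ n - 1 →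
      a j = (t (j + 1 - ε j) - t (j + ε j)) / (t n - t 1))
    (hb : ∀ j, 1 ≤ j → j ≤ n - 1 →
      b j = (t n * t (j + ε j) - t 1 * t (j + 1 - ε j)) / (t n - t 1))
    (L : ℕ → ℝ → ℝ)
    (hL : ∀ j, 1 ≤ j → j ≤ n - 1 → ∀ s : ℝ, L j s = a j * s + b j)
    (lam : ℕ → ℝ)
    -- (i) conditions on the scaling factors
    (hlam0 : ∀ j, 1 ≤ j → j ≤ n - 1 → 0 ≤ lam j)
    (hlam : ∀ j, 1 ≤ j → j ≤ n - 1 →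
      lam j < min |a j| (min (f (j + ε j) / f 1) (f (j + 1 - ε j) / f n)))
    (fs fss ds dss : ℕ → ℝ)
    (hfs : ∀ j, 1 ≤ j → j ≤ n - 1 → fs j = f (j + ε j) - lam j * f 1)
    (hfss : ∀ j, 1 ≤ j → j ≤ n - 1 → fss j = f (j + 1 - ε j) - lam j * f n)
    (hds : ∀ j, 1 ≤ j → j ≤ n - 1 → ds j = a j * d (j + ε j) - lam j * d 1)
    (hdss : ∀ j, 1 ≤ j → j ≤ n - 1 → dss j = a j * d (j + 1 - ε j) - lam j * d n)
    -- (ii) conditions on the shape parameters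
    (α β γ δ : ℕ → ℝ)
    (hα : ∀ j, 1 ≤ j → j ≤ n - 1 → 0 < α j)
    (hδ : ∀ j, 1 ≤ j → j ≤ n - 1 → 0 < δ j)
    (hβ : ∀ j, 1 ≤ j → j ≤ n - 1 →
      β j > max 0 (-(2 * l * α j * ds j) / (π * fs j)))
    (hγ : ∀ j, 1 ≤ j → j ≤ n - 1 →
      γ j > max 0 ((2 * l * δ j * dss j) / (π * fss j)))
    (U V W X : ℕ → ℝ)
    (hU : ∀ j, 1 ≤ j → j ≤ n - 1 → U j = α j * fs j)
    (hV : ∀ j, 1 ≤ j → j ≤ n - 1 → V j = β j * fs j + (2 * l * α j / π) * ds j)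
    (hW : ∀ j, 1 ≤ j → j ≤ n - 1 → W j = γ j * fss j - (2 * l * δ j / π) * dss j)
    (hX : ∀ j, 1 ≤ j → j ≤ n - 1 → X j = δ j * fss j)
    (p q : ℕ → ℝ → ℝ)
    (hp : ∀ j, 1 ≤ j → j ≤ n - 1 → ∀ θ : ℝ,
      p j θ = (1 - sin θ) ^ 3 * U j + sin θ * (1 - sin θ) ^ 2 * V j +
        cos θ * (1 - cos θ) ^ 2 * W j + (1 - cos θ) ^ 3 * X j)
    (hq : ∀ j, 1 ≤ j → j ≤ n - 1 → ∀ θ : ℝ,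
      q j θ = (1 - sin θ) ^ 3 * α j + sin θ * (1 - sin θ) ^ 2 * β j +
        cos θ * (1 - cos θ) ^ 2 * γ j + (1 - cos θ) ^ 3 * δ j)
    (M : ℕ → ℝ → ℝ)
    (hM : ∀ j, 1 ≤ j → j ≤ n - 1 → ∀ s : ℝ, M j s = p j (θf s) / q j (θf s))
    -- `φ` is the (unique) continuous solution of the self-referential equations,
    -- which interpolates the data
    (φ : ℝ → ℝ)
    (hφcont : ContinuousOn φ (Icc (t 1) (t n)))
    (hφeq : ∀ j, 1 ≤ j → j ≤ n - 1 → ∀ s ∈ Icc (t 1) (t n),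
      φ (L j s) = lam j * φ s + M j s)
    (hφinterp : ∀ i, 1 ≤ i → i ≤ n → φ (t i) = f i) :
    ∀ s ∈ Icc (t 1) (t n), 0 < φ s := by
  intro s hs
  have hmono : StrictMonoOn t (Icc 1 n) :=
    strictMonoOn_of_lt_add_one ordConnected_Icc fun i _ hi hi' => by
      simp only [mem_Icc] at hi hi'
      exact ht i hi.1 (by omega)
  have h1n : t 1 < t n := hmono ⟨le_rfl, by omega⟩ ⟨by omega, le_rfl⟩ (by omega)
  have hlpos : 0 < l := by rw [hl]; linarith
  have hθmem : ∀ r ∈ Icc (t 1) (t n), θf r ∈ Icc 0 (π / 2) := by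
    intro r hr
    have hπ := pi_pos
    rw [hθf]
    constructor
    · exact div_nonneg (mul_nonneg (by positivity) (by linarith [hr.1])) hlpos.le
    · rw [div_le_iff₀ hlpos]
      exact mul_le_mul_of_nonneg_left (by linarith [hr.2]) (by positivity)
  have hMpos : ∀ j, 1 ≤ j → j ≤ n - 1 → ∀ r ∈ Icc (t 1) (t n), 0 < M j r := by
    intro j hj hj' r hr
    have hπ := pi_pos
    obtain ⟨-, hlam'⟩ := lt_min_iff.1 (hlam j hj hj')
    obtain ⟨hlam1, hlamn⟩ := lt_min_iff.1 hlam'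
    have hfs0 : 0 < fs j := by
      rw [hfs j hj hj', sub_pos]
      exact (lt_div_iff₀ (hf 1 le_rfl (by omega))).1 hlam1
    have hfss0 : 0 < fss j := by
      rw [hfss j hj hj', sub_pos]
      exact (lt_div_iff₀ (hf n (by omega) le_rfl)).1 hlamn
    have hα0 := hα j hj hj'
    have hδ0 := hδ j hj hj'
    obtain ⟨hβ0, hβ1⟩ := max_lt_iff.1 (hβ j hj hj')
    obtain ⟨hγ0, hγ1⟩ := max_lt_iff.1 (hγ j hj hj')
    have hU0 : 0 < U j := by rw [hU j hj hj']; positivity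
    have hX0 : 0 < X j := by rw [hX j hj hj']; positivity
    have hV0 : 0 < V j := by
      rw [div_lt_iff₀ (by positivity)] at hβ1
      have : V j = (β j * (π * fs j) + 2 * l * α j * ds j) / π := by
        rw [hV j hj hj']; field_simp
      rw [this]
      exact div_pos (by linarith) hπ
    have hW0 : 0 < W j := by
      rw [div_lt_iff₀ (by positivity)] at hγ1
      have : W j = (γ j * (π * fss j) - 2 * l * δ j * dss j) / π := by
        rw [hW j hj hj']; field_simp
      rw [this]
      exact div_pos (by linarith) hπ
    rw [hM j hj hj', hp j hj hj', hq j hj hj']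
    exact div_pos (cubicTrig_pos hU0 hV0 hW0 hX0 (hθmem r hr))
      (cubicTrig_pos hα0 hβ0 hγ0 hδ0 (hθmem r hr))
  obtain ⟨m, hm, hmin⟩ := isCompact_Icc.exists_isMinOn (nonempty_Icc.2 h1n.le) hφcont
  refine lt_of_lt_of_le ?_ (hmin hs)
  obtain ⟨j, hj, hj', hmj⟩ := exists_mem_Icc_succ_s11 n (by omega) hm.1 hm.2
  have htj := ht j hj hj'
  have ht1j : t 1 ≤ t j := hmono.monotoneOn ⟨le_rfl, by omega⟩ ⟨hj, by omega⟩ hj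
  have htjn : t (j + 1) ≤ t n :=
    hmono.monotoneOn ⟨by omega, by omega⟩ ⟨by omega, le_rfl⟩ (by omega)
  obtain ⟨hne, hmem, habs⟩ : t (j + ε j) ≠ t (j + 1 - ε j) ∧
      m ∈ uIcc (t (j + ε j)) (t (j + 1 - ε j)) ∧
      |t (j + 1 - ε j) - t (j + ε j)| = t (j + 1) - t j := by
    rcases hε j hj hj' with h | h
    · simp only [h, add_zero, Nat.sub_zero]
      exact ⟨htj.ne, Icc_subset_uIcc hmj, abs_of_pos (sub_pos.2 htj)⟩
    · simp only [h, Nat.add_sub_cancel]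
      exact ⟨htj.ne', Icc_subset_uIcc' hmj, by
        rw [abs_sub_comm, abs_of_pos (sub_pos.2 htj)]⟩
  obtain ⟨r, hr, hrm⟩ := exists_affine_preimage h1n hne hmem
  have hLr : L j r = m := by rw [hL j hj hj', ha j hj hj', hb j hj hj', hrm]
  have hlam1 : lam j < 1 := by
    refine (lt_min_iff.1 (hlam j hj hj')).1.trans_le ?_
    rw [ha j hj hj', abs_div, habs, abs_of_pos (sub_pos.2 h1n), div_le_one (sub_pos.2 h1n)]
    linarith
  have heq := hφeq j hj hj' r hr
  rw [hLr] at heq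
  have hle : φ m ≤ φ r := hmin hr
  have hM0 := hMpos j hj hj' r hr
  nlinarith [mul_le_mul_of_nonneg_left hle (hlam0 j hj hj')]
end
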